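/- Let V = EuclideanSpace ℝ (Fin 3) with standard orthonormal basis (e_i), and let R : V × V × V × V → ℝ be a multilinear map satisfying R(x,y,z,w) = −R(y,x,z,w), R(x,y,z,w) = −R(x,y,w,z), R(x,y,z,w) = R(z,w,x,y), and the first Bianchi identity R(x,y,z,w) + R(y,z,x,w) + R(z,x,y,w) = 0. Define Ric(x,z) := Σ_p R(x,e_p,z,e_p), S := Σ_a Ric(e_a,e_a), and |Ric|² := Σ_{i,j} Ric(e_i,e_j)². Then for all indices a, b: Σ_{p,q,s} R(e_a,e_p,e_q,e_s)·R(e_b,e_p,e_q,e_s) = 2·(−Σ_s Ric(e_a,e_s)·Ric(e_s,e_b) + S·Ric(e_a,e_b) + |Ric|²·δ_{ab} − (S²/2)·δ_{ab}). -/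

import Mathlib

open RealInnerProductSpace

/-- The standard orthonormal basis vectors of `EuclideanSpace ℝ (Fin 3)`. -/
noncomputable def e3 (i : Fin 3) : EuclideanSpace ℝ (Fin 3) :=
  EuclideanSpace.single i 1

/-- The Ricci contraction `Ric(x,z) = Σ_p R(x,e_p,z,e_p)` of a (multilinear)
curvature tensor `R` on `EuclideanSpace ℝ (Fin 3)`. -/
noncomputable def ricci3
    (R : EuclideanSpace ℝ (Fin 3) →ₗ[ℝ] EuclideanSpace ℝ (Fin 3) →ₗ[ℝ]
      EuclideanSpace ℝ (Fin 3) →ₗ[ℝ] EuclideanSpace ℝ (Fin 3) →ₗ[ℝ] ℝ)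
    (x z : EuclideanSpace ℝ (Fin 3)) : ℝ :=
  ∑ p : Fin 3, R x (e3 p) z (e3 p)

/-- The scalar curvature `S = Σ_a Ric(e_a,e_a)`. -/
noncomputable def scal3
    (R : EuclideanSpace ℝ (Fin 3) →ₗ[ℝ] EuclideanSpace ℝ (Fin 3) →ₗ[ℝ]
      EuclideanSpace ℝ (Fin 3) →ₗ[ℝ] EuclideanSpace ℝ (Fin 3) →ₗ[ℝ] ℝ) : ℝ :=
  ∑ a : Fin 3, ricci3 R (e3 a) (e3 a)

/-- The squared Ricci norm `|Ric|² = Σ_{i,j} Ric(e_i,e_j)²`. -/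
noncomputable def ricNormSq3
    (R : EuclideanSpace ℝ (Fin 3) →ₗ[ℝ] EuclideanSpace ℝ (Fin 3) →ₗ[ℝ]
      EuclideanSpace ℝ (Fin 3) →ₗ[ℝ] EuclideanSpace ℝ (Fin 3) →ₗ[ℝ] ℝ) : ℝ :=
  ∑ i : Fin 3, ∑ j : Fin 3, (ricci3 R (e3 i) (e3 j)) ^ 2

/-- In dimension three the quadratic curvature contraction `R_{apqs}R_b^{pqs}`
appearing in the RG-2 flow is expressed by the Ricci tensor alone:
`Σ_{p,q,s} R(e_a,e_p,e_q,e_s)R(e_b,e_p,e_q,e_s)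
  = 2(−Σ_s Ric(e_a,e_s)Ric(e_s,e_b) + S·Ric(e_a,e_b) + |Ric|²δ_{ab} − (S²/2)δ_{ab})`. -/
theorem three_dim_quadratic_curvature_contraction
    (R : EuclideanSpace ℝ (Fin 3) →ₗ[ℝ] EuclideanSpace ℝ (Fin 3) →ₗ[ℝ]
      EuclideanSpace ℝ (Fin 3) →ₗ[ℝ] EuclideanSpace ℝ (Fin 3) →ₗ[ℝ] ℝ)
    (hanti1 : ∀ x y z w, R x y z w = -R y x z w)
    (hanti2 : ∀ x y z w, R x y z w = -R x y w z)
    (hpair : ∀ x y z w, R x y z w = R z w x y)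
    (hbianchi : ∀ x y z w, R x y z w + R y z x w + R z x y w = 0) :
    ∀ a b : Fin 3,
      ∑ p : Fin 3, ∑ q : Fin 3, ∑ s : Fin 3,
          R (e3 a) (e3 p) (e3 q) (e3 s) * R (e3 b) (e3 p) (e3 q) (e3 s)
        = 2 * (-(∑ s : Fin 3, ricci3 R (e3 a) (e3 s) * ricci3 R (e3 s) (e3 b))
            + scal3 R * ricci3 R (e3 a) (e3 b)
            + ricNormSq3 R * (if a = b then (1 : ℝ) else 0)
            - (scal3 R ^ 2 / 2) * (if a = b then (1 : ℝ) else 0)) := by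
  have z1 : ∀ x z w, R x x z w = 0 := fun x z w => by linarith [hanti1 x x z w]
  have z2 : ∀ x y z, R x y z z = 0 := fun x y z => by linarith [hanti2 x y z z]
  have a10 := hanti1 (e3 1) (e3 0)
  have a20 := hanti1 (e3 2) (e3 0)
  have a21 := hanti1 (e3 2) (e3 1)
  have b10 := fun x y => hanti2 x y (e3 1) (e3 0)
  have b20 := fun x y => hanti2 x y (e3 2) (e3 0)
  have b21 := fun x y => hanti2 x y (e3 2) (e3 1)
  have p1 := hpair (e3 0) (e3 2) (e3 0) (e3 1)
  have p2 := hpair (e3 1) (e3 2) (e3 0) (e3 1)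
  have p3 := hpair (e3 1) (e3 2) (e3 0) (e3 2)
  clear hanti1 hanti2 hpair hbianchi
  intro a b
  fin_cases a <;> fin_cases b <;>
    simp [scal3, ricNormSq3, ricci3, Fin.sum_univ_three, z1, z2, a10, a20, a21,
      b10, b20, b21, p1, p2, p3] <;> ring
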